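/- (Proposition 2.4: cyclic symmetry of the left block.) Let N ≥ 3. For s ∈ ℤ/Nℤ set P_s := e_q(−x̌_s) ∘ e_q(−x̌_s∘x̌_{s+1}) ∘ ⋯ ∘ e_q(−x̌_s∘x̌_{s+1}∘⋯∘x̌_{s+N−2}) ∘ e_q(−x̌_{s+N−1}) ∘ e_q(−x̌_{s+N−2}) ∘ ⋯ ∘ e_q(−x̌_{s+1}) (indices mod N). Then P_s is independent of s, i.e. P_s = P_{s+1} for every s ∈ ℤ/Nℤ. (Equivalently, the left block A_L of the non-stationary affine gl_N Hamiltonian is invariant under the cyclic rotation π(x̌_i) = x̌_{i+1} of the Dynkin diagram of A_{N−1}^{(1)}.) -/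

import Mathlib

/-!
Proposition 2.4 (cyclic symmetry of the left block).  Setting as in the paper:
`V = MvPowerSeries (ZMod N) ℂ`, `p i : x^ν ↦ q^{ν_i} x^ν`,
`x̌_i = M_{x_i} ∘ p_i⁻¹ ∘ p_{i−1}`, and for degree-raising `T`,
`e_q(−T) = ∑ (−1)ⁿTⁿ/(q;q)_n`, defined by its (finite) coefficientwise sums.
-/

noncomputable section
open scoped Classical

variable {N : ℕ}

def qPoch (q : ℂ) (n : ℕ) : ℂ := ∏ k ∈ Finset.range n, (1 - q ^ (k + 1))

def degOf (ν : ZMod N →₀ ℕ) : ℕ := ν.sum fun _ k => k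

def pmap (q : ℂ) (i : ZMod N) (f : MvPowerSeries (ZMod N) ℂ) : MvPowerSeries (ZMod N) ℂ :=
  fun ν => q ^ (ν i) * f ν

def pinv (q : ℂ) (i : ZMod N) (f : MvPowerSeries (ZMod N) ℂ) : MvPowerSeries (ZMod N) ℂ :=
  fun ν => q ^ (-(ν i : ℤ)) * f ν

/-- `x̌_i := M_{x_i} ∘ p_i⁻¹ ∘ p_{i−1}`. -/
def xcheck (q : ℂ) (i : ZMod N) (f : MvPowerSeries (ZMod N) ℂ) : MvPowerSeries (ZMod N) ℂ :=
  MvPowerSeries.X i * pinv q i (pmap q (i - 1) f)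

def eqExp (q : ℂ) (T : MvPowerSeries (ZMod N) ℂ → MvPowerSeries (ZMod N) ℂ)
    (f : MvPowerSeries (ZMod N) ℂ) : MvPowerSeries (ZMod N) ℂ :=
  fun ν => ∑ n ∈ Finset.range (degOf ν + 1), ((-1 : ℂ) ^ n / qPoch q n) * (T^[n] f) ν

def compAsc {α : Type*} (F : ℕ → α → α) : ℕ → α → α
  | 0 => id
  | k + 1 => compAsc F k ∘ F k

def compDesc {α : Type*} (F : ℕ → α → α) : ℕ → α → α
  | 0 => id
  | k + 1 => F k ∘ compDesc F k

/-- `P_s := e(−x̌_s) ∘ e(−x̌_s x̌_{s+1}) ∘ ⋯ ∘ e(−x̌_s⋯x̌_{s+N−2})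
            ∘ e(−x̌_{s+N−1}) ∘ e(−x̌_{s+N−2}) ∘ ⋯ ∘ e(−x̌_{s+1})`. -/
def Pblock (q : ℂ) (N : ℕ) [NeZero N] (s : ZMod N) :
    MvPowerSeries (ZMod N) ℂ → MvPowerSeries (ZMod N) ℂ :=
  (compAsc (fun j =>
      eqExp q (compAsc (fun m => xcheck (N := N) q (s + (m : ℕ))) (j + 1))) (N - 1))
    ∘ (compDesc (fun j => eqExp q (xcheck (N := N) q (s + ((j + 1 : ℕ) : ZMod N)))) (N - 1))

section QExponential

/-- The Gaussian binomial coefficient. -/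
def gaussBinom (q : ℂ) : ℕ → ℕ → ℂ
  | _, 0 => 1
  | 0, _ + 1 => 0
  | n + 1, b + 1 => gaussBinom q n b + q ^ (b + 1) * gaussBinom q n (b + 1)

@[simp] lemma gaussBinom_zero_right (q : ℂ) (n : ℕ) : gaussBinom q n 0 = 1 := by
  cases n <;> rfl

lemma gaussBinom_eq_zero (q : ℂ) {n b : ℕ} (h : n < b) : gaussBinom q n b = 0 := by
  induction n generalizing b with
  | zero => obtain ⟨b, rfl⟩ := Nat.exists_eq_add_of_lt h; simp [gaussBinom]
  | succ n ih =>
    obtain ⟨b, rfl⟩ := Nat.exists_eq_succ_of_ne_zero (by omega : b ≠ 0)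
    simp [gaussBinom, ih (by omega : n < b), ih (by omega : n < b + 1)]

lemma qPoch_succ (q : ℂ) (n : ℕ) : qPoch q (n + 1) = qPoch q n * (1 - q ^ (n + 1)) :=
  Finset.prod_range_succ _ _

@[simp] lemma qPoch_zero (q : ℂ) : qPoch q 0 = 1 := rfl

lemma qPoch_ne_zero {q : ℂ} (hq : ∀ n : ℕ, 0 < n → q ^ n ≠ 1) (n : ℕ) : qPoch q n ≠ 0 :=
  Finset.prod_ne_zero_iff.2 fun k _ => sub_ne_zero.2 (hq (k + 1) k.succ_pos).symm

lemma gaussBinom_mul_qPoch (q : ℂ) (a b : ℕ) :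
    gaussBinom q (a + b) b * (qPoch q a * qPoch q b) = qPoch q (a + b) := by
  induction b generalizing a with
  | zero => simp
  | succ b ihb =>
    induction a with
    | zero =>
      have h := ihb 0
      rw [zero_add] at h ⊢
      rw [gaussBinom, gaussBinom_eq_zero q (Nat.lt_succ_self b), qPoch_succ]
      linear_combination (1 - q ^ (b + 1)) * h
    | succ a iha =>
      have h := ihb (a + 1)
      rw [show a + 1 + (b + 1) = (a + b + 1) + 1 by omega, gaussBinom, qPoch_succ q (a + b + 1)]
      rw [show a + 1 + b = a + b + 1 by omega] at h
      rw [show a + (b + 1) = a + b + 1 by omega] at iha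
      rw [qPoch_succ q b] at iha ⊢
      rw [qPoch_succ q a] at h ⊢
      linear_combination (1 - q ^ (b + 1)) * h + q ^ (b + 1) * (1 - q ^ (a + 1)) * iha

/-- Cauchy's expansion of a monomial in the basis `∏ (z - q ^ i)`. -/
lemma sum_gaussBinom_mul_prod (q z : ℂ) (n : ℕ) :
    ∑ b ∈ Finset.range (n + 1), gaussBinom q n b * ∏ i ∈ Finset.range b, (z - q ^ i) = z ^ n := by
  induction n with
  | zero => simp
  | succ n ih =>
    have h : ∑ b ∈ Finset.range (n + 1),
        q ^ (b + 1) * gaussBinom q n (b + 1) * ∏ i ∈ Finset.range (b + 1), (z - q ^ i) + 1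
        = ∑ b ∈ Finset.range (n + 1),
            q ^ b * gaussBinom q n b * ∏ i ∈ Finset.range b, (z - q ^ i) := by
      have := Finset.sum_range_succ' (fun b => q ^ b * gaussBinom q n b *
        ∏ i ∈ Finset.range b, (z - q ^ i)) (n + 1)
      rw [Finset.sum_range_succ, gaussBinom_eq_zero q (Nat.lt_succ_self n)] at this
      simpa using this.symm
    rw [Finset.sum_range_succ', pow_succ, ← ih, Finset.sum_mul]
    simp only [gaussBinom, add_mul, Finset.sum_add_distrib, Finset.range_zero, Finset.prod_empty, mul_one]
    rw [add_assoc, h, ← Finset.sum_add_distrib]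
    refine Finset.sum_congr rfl fun b _ => ?_
    rw [Finset.prod_range_succ]
    ring

lemma prod_pow_sub_pow (q : ℂ) (a b : ℕ) :
    (∏ i ∈ Finset.range b, (q ^ (a + b) - q ^ i)) * qPoch q a
      = (-1) ^ b * q ^ (b.choose 2) * qPoch q (a + b) := by
  induction b generalizing a with
  | zero => simp
  | succ b ih =>
    have h := ih (a + 1)
    rw [show a + 1 + b = a + (b + 1) by omega, qPoch_succ] at h
    rw [Finset.prod_range_succ, Nat.choose_succ_succ' b 1, Nat.choose_one_right]
    have e : q ^ (a + (b + 1)) - q ^ b = - q ^ b * (1 - q ^ (a + 1)) := by ring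
    rw [e]
    linear_combination (- q ^ b) * h

/-- The coefficient of `T ^ n` in `e_q(-T)`. -/
def qCoeff (q : ℂ) (n : ℕ) : ℂ := (-1) ^ n / qPoch q n

lemma sum_qCoeff {q : ℂ} (hq : ∀ n : ℕ, 0 < n → q ^ n ≠ 1) {n k : ℕ} (hn : n < k) (m : ℕ) :
    ∑ b ∈ Finset.range k, qCoeff q b * q ^ (b.choose 2) *
        ((if b ≤ n then qCoeff q (n - b) else 0) * (if b ≤ m then qCoeff q (m - b) else 0))
      = qCoeff q m * qCoeff q n * q ^ (m * n) := by
  have hP := qPoch_ne_zero hq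
  rw [← Finset.sum_subset (Finset.range_mono (by omega : n + 1 ≤ k)), pow_mul,
    ← sum_gaussBinom_mul_prod, Finset.mul_sum]
  · refine Finset.sum_congr rfl fun b hb => ?_
    obtain ⟨a, rfl⟩ := Nat.exists_eq_add_of_le' (Nat.lt_succ_iff.1 (Finset.mem_range.1 hb))
    by_cases hm : b ≤ m
    · obtain ⟨c, rfl⟩ := Nat.exists_eq_add_of_le' hm
      have h1 := gaussBinom_mul_qPoch q a b
      have h2 := prod_pow_sub_pow q c b
      simp only [le_add_iff_nonneg_left, zero_le, if_true, Nat.add_sub_cancel, qCoeff]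
      have h3 : (-1 : ℂ) ^ b * (-1) ^ b = 1 := by rw [← mul_pow]; simp
      rw [← eq_div_iff (mul_ne_zero (hP a) (hP b))] at h1
      rw [← eq_div_iff (hP c)] at h2
      rw [h1, h2]
      have := hP a; have := hP b; have := hP c
      have := hP (a + b); have := hP (c + b)
      field_simp
      rw [pow_add, pow_add]
      linear_combination (-q ^ (b.choose 2) * (-1 : ℂ) ^ a * (-1) ^ c) * h3
    · rw [Finset.prod_eq_zero (Finset.mem_range.2 (not_le.1 hm)) (sub_self _)]
      simp [hm]
  · intro b _ hb
    rw [if_neg (by simpa using hb)]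
    simp

variable {A : Type*} [Ring A] [Algebra ℂ A]

/-- The series `e_q(-t)`, truncated after `k` terms. -/
def qExpTrunc (q : ℂ) (k : ℕ) (t : A) : A := ∑ n ∈ Finset.range k, qCoeff q n • t ^ n

lemma Commute.qExpTrunc {q : ℂ} {k : ℕ} {x y : A} (h : Commute x y) :
    Commute (qExpTrunc q k x) (qExpTrunc q k y) :=
  Commute.sum_left _ _ _ fun _ _ => Commute.sum_right _ _ _ fun _ _ =>
    ((h.pow_pow _ _).smul_left _).smul_right _

lemma qExpTrunc_mul_pow (q : ℂ) {k : ℕ} {x : A} (hx : x ^ k = 0) (b : ℕ) :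
    qExpTrunc q k x * x ^ b
      = ∑ n ∈ Finset.range k, (if b ≤ n then qCoeff q (n - b) else 0) • x ^ n := by
  have hx' : ∀ n, k ≤ n → x ^ n = 0 := fun n hn => pow_eq_zero_of_le hn hx
  simp only [ite_smul, zero_smul]
  rw [← Finset.sum_filter, qExpTrunc, Finset.sum_mul,
    ← Finset.sum_subset (Finset.range_mono (Nat.sub_le k b)),
    show (Finset.range k).filter (fun n => b ≤ n) = Finset.Ico b k by
      ext; simp [and_comm], Finset.sum_Ico_eq_sum_range]
  · refine Finset.sum_congr rfl fun a _ => ?_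
    rw [Nat.add_sub_cancel_left, smul_mul_assoc, ← pow_add, add_comm]
  · intro a _ ha
    rw [smul_mul_assoc, ← pow_add, hx' _ (by simp at ha; omega), smul_zero]

lemma qcomm_mul_pow {q : ℂ} {x y : A} (h : y * x = q • (x * y)) (n : ℕ) :
    y * x ^ n = q ^ n • (x ^ n * y) := by
  induction n with
  | zero => simp
  | succ n ih =>
    rw [pow_succ, ← mul_assoc, ih, smul_mul_assoc, mul_assoc, h, mul_smul_comm, smul_smul,
      ← mul_assoc, pow_succ]

lemma qcomm_pow_mul_pow {q : ℂ} {x y : A} (h : y * x = q • (x * y)) (m n : ℕ) :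
    y ^ m * x ^ n = q ^ (m * n) • (x ^ n * y ^ m) := by
  induction m with
  | zero => simp
  | succ m ih =>
    rw [pow_succ', mul_assoc, ih, mul_smul_comm, ← mul_assoc, qcomm_mul_pow h, smul_mul_assoc,
      smul_smul, mul_assoc, ← pow_add, Nat.succ_mul]

lemma qcomm_mul_pow_eq {q : ℂ} {x y : A} (h : y * x = q • (x * y)) (b : ℕ) :
    (x * y) ^ b = q ^ (b.choose 2) • (x ^ b * y ^ b) := by
  induction b with
  | zero => simp
  | succ b ih =>
    have := qcomm_pow_mul_pow h b 1
    rw [pow_one, mul_one] at this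
    rw [pow_succ, ih, smul_mul_assoc, mul_assoc, ← mul_assoc (y ^ b), this, smul_mul_assoc,
      mul_smul_comm, smul_smul, Nat.choose_succ_succ' b 1, Nat.choose_one_right, pow_succ x,
      pow_succ y, add_comm b, pow_add]
    simp only [mul_assoc]

/-- The pentagon identity for the `q`-exponential of nilpotent `q`-commuting elements. -/
lemma qExpTrunc_pentagon {q : ℂ} (hq : ∀ n : ℕ, 0 < n → q ^ n ≠ 1) {k : ℕ} {x y : A}
    (h : y * x = q • (x * y)) (hx : x ^ k = 0) (hy : y ^ k = 0) :
    qExpTrunc q k y * qExpTrunc q k x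
      = qExpTrunc q k x * qExpTrunc q k (x * y) * qExpTrunc q k y := by
  have hy' (b : ℕ) : y ^ b * qExpTrunc q k y
      = ∑ n ∈ Finset.range k, (if b ≤ n then qCoeff q (n - b) else 0) • y ^ n := by
    rw [← qExpTrunc_mul_pow q hy]
    exact Commute.sum_right _ _ _ fun _ _ => ((Commute.refl y).pow_pow _ _).smul_right _
  have e : qExpTrunc q k x * qExpTrunc q k (x * y) * qExpTrunc q k y
      = ∑ b ∈ Finset.range k, (qCoeff q b * q ^ (b.choose 2)) •
          ((qExpTrunc q k x * x ^ b) * (y ^ b * qExpTrunc q k y)) := by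
    rw [qExpTrunc.eq_def q k (x * y), Finset.mul_sum, Finset.sum_mul]
    refine Finset.sum_congr rfl fun b _ => ?_
    rw [qcomm_mul_pow_eq h, smul_smul, mul_smul_comm, smul_mul_assoc]
    simp only [mul_assoc]
  rw [e]
  simp only [qExpTrunc_mul_pow q hx, hy', Finset.sum_mul_sum, Finset.smul_sum, smul_mul_smul_comm,
    smul_smul]
  rw [Finset.sum_comm, qExpTrunc, qExpTrunc, Finset.sum_mul_sum, Finset.sum_comm]
  refine Finset.sum_congr rfl fun n hn => ?_
  rw [Finset.sum_comm]
  refine Finset.sum_congr rfl fun m _ => ?_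
  rw [← Finset.sum_smul, sum_qCoeff hq (Finset.mem_range.1 hn), smul_mul_smul_comm,
    qcomm_pow_mul_pow h, smul_smul]

end QExponential

section OrderedProducts

variable {M : Type*} [Monoid M]

/-- `F 0 * F 1 * ⋯ * F (n - 1)`. -/
def ascProd (F : ℕ → M) : ℕ → M
  | 0 => 1
  | k + 1 => ascProd F k * F k

/-- `F (n - 1) * ⋯ * F 1 * F 0`. -/
def descProd (F : ℕ → M) : ℕ → M
  | 0 => 1
  | k + 1 => F k * descProd F k

lemma ascProd_succ' (F : ℕ → M) (n : ℕ) :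
    ascProd F (n + 1) = F 0 * ascProd (fun m => F (m + 1)) n := by
  induction n with
  | zero => simp [ascProd]
  | succ n ih => rw [ascProd, ih, mul_assoc, ascProd]

lemma Commute.ascProd_right {F : ℕ → M} {x : M} {n : ℕ} (h : ∀ m < n, Commute x (F m)) :
    Commute x (ascProd F n) := by
  induction n with
  | zero => exact Commute.one_right x
  | succ n ih => exact (ih fun m hm => h m (hm.trans n.lt_succ_self)).mul_right (h n n.lt_succ_self)

end OrderedProducts

section AffineRelations

variable {A : Type*} [Ring A] [Algebra ℂ A]

/-- The rotation invariance of the left block, for nilpotent elements `a 0, …, a (n + 1)` of an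
algebra with the commutation relations of the cyclic quiver. -/
lemma qExpTrunc_rotation {q : ℂ} (hq0 : q ≠ 0) (hq : ∀ n : ℕ, 0 < n → q ^ n ≠ 1) {k n : ℕ}
    (hn : 0 < n) (a : ℕ → A)
    (hsucc : ∀ i ≤ n, a (i + 1) * a i = q • (a i * a (i + 1)))
    (hfar : ∀ i j, i + 2 ≤ j → j ≤ n + 1 → (i ≠ 0 ∨ j ≠ n + 1) → Commute (a i) (a j))
    (hlast : a 0 * a (n + 1) = q • (a (n + 1) * a 0))
    (hnil : ∀ i, a i ^ k = 0)
    (hnil' : ∀ j, ascProd (fun m => a (m + 1)) (j + 1) ^ k = 0) :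
    ascProd (fun j => qExpTrunc q k (ascProd a (j + 1))) (n + 1)
        * descProd (fun j => qExpTrunc q k (a (j + 1))) (n + 1)
      = ascProd (fun j => qExpTrunc q k (ascProd (fun m => a (m + 1)) (j + 1))) (n + 1)
        * (qExpTrunc q k (a 0) * descProd (fun j => qExpTrunc q k (a (j + 2))) n) := by
  set E : A → A := qExpTrunc q k with hE
  set p : ℕ → A := ascProd (fun m => a (m + 1)) with hp
  have p_succ (j : ℕ) : p (j + 1) = p j * a (j + 1) := rfl
  have p_one : p 1 = a 1 := by simp [hp, ascProd]
  have a_comm_p {j i : ℕ} (h : j + 2 ≤ i) (hi : i ≤ n + 1) : Commute (a i) (p j) :=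
    Commute.ascProd_right fun m hm => (hfar (m + 1) i (by omega) hi (by omega)).symm
  have a_mul_p {j : ℕ} (hj : j + 1 ≤ n) :
      a (j + 2) * p (j + 1) = q • (p (j + 1) * a (j + 2)) := by
    rw [p_succ, ← mul_assoc, (a_comm_p le_rfl (by omega)).eq, mul_assoc, hsucc _ hj,
      mul_smul_comm, mul_assoc]
  have p_mul_a {j : ℕ} (hj : j + 1 ≤ n) : p (j + 1) * a 0 = q • (a 0 * p (j + 1)) := by
    induction j with
    | zero => rw [p_one]; exact hsucc 0 (Nat.zero_le _)
    | succ j ih =>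
      rw [p_succ (j + 1), mul_assoc, ← (hfar 0 (j + 2) (by omega) (by omega) (by omega)).eq,
        ← mul_assoc, ih (by omega), smul_mul_assoc, mul_assoc]
  have p_last : Commute (p (n + 1)) (a 0) := by
    obtain ⟨j, rfl⟩ := Nat.exists_eq_succ_of_ne_zero hn.ne'
    have h := p_mul_a (j := j) le_rfl
    have hl : q • (p (j + 2) * a 0) = q • (a 0 * p (j + 2)) := by
      rw [p_succ (j + 1), mul_assoc, ← mul_smul_comm, ← hlast, ← mul_assoc, h, smul_mul_assoc,
        mul_assoc]
    exact smul_right_injective A hq0 hl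
  have p_mul_p {i j : ℕ} (hij : j < i) (hi : i ≤ n) :
      p (i + 1) * p (j + 1) = q • (p (j + 1) * p (i + 1)) := by
    induction i, hij using Nat.le_induction with
    | base => rw [p_succ (j + 1), mul_assoc, a_mul_p (by omega), mul_smul_comm]
    | succ i hji ih =>
      rw [p_succ (i + 1), mul_assoc, (a_comm_p (by omega) (by omega)).eq, ← mul_assoc,
        ih (by omega), smul_mul_assoc, mul_assoc]
  have comm {i j : ℕ} (hij : j < i) (hi : i + 1 ≤ n) :
      Commute (ascProd a (i + 2)) (p (j + 1)) := by
    change ascProd a (i + 2) * p (j + 1) = p (j + 1) * ascProd a (i + 2)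
    rw [ascProd_succ' a (i + 1), mul_assoc]
    change a 0 * (p (i + 1) * p (j + 1)) = p (j + 1) * (a 0 * p (i + 1))
    rw [p_mul_p hij (by omega), ← mul_assoc, p_mul_a (by omega), mul_smul_comm, smul_mul_assoc,
      mul_assoc]
  set G : ℕ → A := ascProd (fun j => E (p (j + 1))) with hG
  set K : ℕ → A := ascProd (fun j => E (ascProd a (j + 1))) with hK
  have G_succ (j : ℕ) : G (j + 1) = G j * E (p (j + 1)) := rfl
  have K_succ (j : ℕ) : K (j + 1) = K j * E (ascProd a (j + 1)) := rfl
  have desc_eq {j : ℕ} (hj : j ≤ n) : descProd (fun j => E (a (j + 1))) (j + 1)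
      = G (j + 1) * descProd (fun j => E (a (j + 2))) j := by
    induction j with
    | zero => simp [hG, descProd, ascProd, p_one]
    | succ j ih =>
      have hc : Commute (E (a (j + 2))) (G j) :=
        Commute.ascProd_right fun m hm => (a_comm_p (by omega) (by omega)).qExpTrunc
      have hpent := qExpTrunc_pentagon hq (a_mul_p hj) (hnil' j) (hnil (j + 2))
      rw [descProd, ih (by omega), descProd, G_succ (j + 1), G_succ j]
      change E (a (j + 2)) * E (p (j + 1)) = E (p (j + 1)) * E (p (j + 2)) * E (a (j + 2)) at hpent
      calc E (a (j + 2)) * (G j * E (p (j + 1)) * descProd (fun j => E (a (j + 2))) j)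
          = E (a (j + 2)) * G j * E (p (j + 1)) * descProd (fun j => E (a (j + 2))) j := by
            simp only [mul_assoc]
        _ = G j * (E (a (j + 2)) * E (p (j + 1))) * descProd (fun j => E (a (j + 2))) j := by
            rw [hc.eq]; simp only [mul_assoc]
        _ = _ := by rw [hpent]; simp only [mul_assoc]
  have GE {j : ℕ} (hj : j ≤ n) : G j * E (a 0) = K (j + 1) * G j := by
    induction j with
    | zero => simp [hG, hK, ascProd]
    | succ j ih =>
      have hc : Commute (E (ascProd a (j + 2))) (G j) :=
        Commute.ascProd_right fun m hm => (comm hm hj).qExpTrunc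
      have hpent := qExpTrunc_pentagon hq (p_mul_a hj) (hnil 0) (hnil' j)
      rw [← ascProd_succ' a (j + 1)] at hpent
      change E (p (j + 1)) * E (a 0) = E (a 0) * E (ascProd a (j + 2)) * E (p (j + 1)) at hpent
      calc G j * E (p (j + 1)) * E (a 0)
          = G j * E (a 0) * E (ascProd a (j + 2)) * E (p (j + 1)) := by
            rw [mul_assoc, hpent]; simp only [mul_assoc]
        _ = K (j + 1) * (G j * E (ascProd a (j + 2))) * E (p (j + 1)) := by
            rw [ih (by omega)]; simp only [mul_assoc]
        _ = _ := by rw [← hc.eq, K_succ (j + 1), G_succ]; simp only [mul_assoc]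
  have hl : Commute (E (p (n + 1))) (E (a 0)) := p_last.qExpTrunc
  rw [desc_eq le_rfl, ← mul_assoc, ← mul_assoc]
  congr 1
  rw [G_succ, ← mul_assoc, ← GE le_rfl, mul_assoc, mul_assoc, hl.eq]

end AffineRelations

section Truncation

lemma degOf_add (μ ν : ZMod N →₀ ℕ) : degOf (μ + ν) = degOf μ + degOf ν :=
  Finsupp.sum_add_index' (fun _ => rfl) fun _ _ _ => rfl

@[simp] lemma degOf_single (i : ZMod N) (m : ℕ) : degOf (Finsupp.single i m) = m :=
  Finsupp.sum_single_index rfl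

lemma X_mul_apply (i : ZMod N) (f : MvPowerSeries (ZMod N) ℂ) (ν : ZMod N →₀ ℕ) :
    (MvPowerSeries.X i * f : MvPowerSeries (ZMod N) ℂ) ν
      = ∑ μ ∈ Finset.HasAntidiagonal.antidiagonal ν,
      (if μ.1 = Finsupp.single i 1 then 1 else 0) * f μ.2 := by
  have := MvPowerSeries.coeff_mul ν (MvPowerSeries.X i) f
  simp only [MvPowerSeries.coeff_X] at this
  exact this

/-- The power series of order at least `k`. -/
def orderGE (N k : ℕ) : Submodule ℂ (MvPowerSeries (ZMod N) ℂ) where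
  carrier := {f | ∀ ν, degOf ν < k → f ν = 0}
  zero_mem' _ _ := rfl
  add_mem' {f g} hf hg ν hν := by
    change f ν + g ν = 0
    rw [hf ν hν, hg ν hν, add_zero]
  smul_mem' c f hf ν hν := by
    change c * f ν = 0
    rw [hf ν hν, mul_zero]

/-- An operator is degree-raising if it maps series of order `≥ k` to series of order `≥ k + 1`. -/
def DegreeRaising (T : MvPowerSeries (ZMod N) ℂ → MvPowerSeries (ZMod N) ℂ) : Prop :=
  ∀ k, ∀ f ∈ orderGE N k, T f ∈ orderGE N (k + 1)

lemma DegreeRaising.comp {S T : MvPowerSeries (ZMod N) ℂ → MvPowerSeries (ZMod N) ℂ}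
    (hS : DegreeRaising S) (hT : DegreeRaising T) : DegreeRaising (S ∘ T) := by
  intro k f hf ν hν
  exact hS _ _ (hT _ _ hf) ν (by omega)

lemma DegreeRaising.iterate_mem {T : MvPowerSeries (ZMod N) ℂ → MvPowerSeries (ZMod N) ℂ}
    (hT : DegreeRaising T) (f : MvPowerSeries (ZMod N) ℂ) (n : ℕ) : T^[n] f ∈ orderGE N n := by
  induction n with
  | zero => exact fun ν hν => absurd hν (Nat.not_lt_zero _)
  | succ n ih => rw [Function.iterate_succ_apply']; exact hT _ _ ih

lemma DegreeRaising.compAsc {F : ℕ → MvPowerSeries (ZMod N) ℂ → MvPowerSeries (ZMod N) ℂ}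
    (hF : ∀ m, DegreeRaising (F m)) (j : ℕ) : DegreeRaising (compAsc F (j + 1)) := by
  induction j with
  | zero => exact hF 0
  | succ j ih => exact ih.comp (hF _)

lemma xcheck_degreeRaising (q : ℂ) (i : ZMod N) : DegreeRaising (xcheck q i) := by
  intro k f hf ν hν
  rw [xcheck, X_mul_apply]
  refine Finset.sum_eq_zero fun μ hμ => ?_
  split_ifs with h
  · have hd : degOf μ.1 + degOf μ.2 = degOf ν := by
      rw [← degOf_add, Finset.HasAntidiagonal.mem_antidiagonal.1 hμ]
    rw [h, degOf_single] at hd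
    simp [pinv, pmap, hf μ.2 (by omega)]
  · rw [zero_mul]

/-- `xcheck` as a linear map. -/
def xcheckLin (q : ℂ) (i : ZMod N) : Module.End ℂ (MvPowerSeries (ZMod N) ℂ) where
  toFun := xcheck q i
  map_add' f g := by
    rw [xcheck, xcheck, xcheck, ← mul_add]
    congr 1
    funext ν
    change _ * (_ * (f ν + g ν)) = _ * (_ * f ν) + _ * (_ * g ν)
    ring
  map_smul' c f := by
    rw [xcheck, xcheck, RingHom.id_apply, ← mul_smul_comm]
    congr 1
    funext ν
    change _ * (_ * (c * f ν)) = c * (_ * (_ * f ν))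
    ring

lemma pmap_X_mul (q : ℂ) (i j : ZMod N) (f : MvPowerSeries (ZMod N) ℂ) :
    pmap q i (MvPowerSeries.X j * f)
      = (if j = i then q else 1) • (MvPowerSeries.X j * pmap q i f) := by
  funext ν
  change q ^ ν i * (MvPowerSeries.X j * f : MvPowerSeries (ZMod N) ℂ) ν
    = (if j = i then q else 1) * (MvPowerSeries.X j * pmap q i f : MvPowerSeries (ZMod N) ℂ) ν
  rw [X_mul_apply, X_mul_apply, Finset.mul_sum, Finset.mul_sum]
  refine Finset.sum_congr rfl fun μ hμ => ?_
  split_ifs with h1 h2 <;> simp [pmap, ← Finset.HasAntidiagonal.mem_antidiagonal.1 hμ, *, pow_add, mul_assoc]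

lemma pinv_X_mul {q : ℂ} (hq0 : q ≠ 0) (i j : ZMod N) (f : MvPowerSeries (ZMod N) ℂ) :
    pinv q i (MvPowerSeries.X j * f)
      = (if j = i then q⁻¹ else 1) • (MvPowerSeries.X j * pinv q i f) := by
  funext ν
  change q ^ (-(ν i : ℤ)) * (MvPowerSeries.X j * f : MvPowerSeries (ZMod N) ℂ) ν
    = (if j = i then q⁻¹ else 1) * (MvPowerSeries.X j * pinv q i f : MvPowerSeries (ZMod N) ℂ) ν
  rw [X_mul_apply, X_mul_apply, Finset.mul_sum, Finset.mul_sum]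
  refine Finset.sum_congr rfl fun μ hμ => ?_
  split_ifs with h1 h2
  · simp only [pinv, ← Finset.HasAntidiagonal.mem_antidiagonal.1 hμ, h1, h2, Finsupp.add_apply,
      Finsupp.single_eq_same]
    rw [Nat.cast_add, neg_add, zpow_add₀ hq0]
    simp [mul_assoc]
  all_goals simp [pinv, ← Finset.HasAntidiagonal.mem_antidiagonal.1 hμ, *]

lemma pinv_smul (q c : ℂ) (i : ZMod N) (f : MvPowerSeries (ZMod N) ℂ) :
    pinv q i (c • f) = c • pinv q i f := by
  funext ν
  change _ * (c * f ν) = c * (_ * f ν)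
  ring

/-- The diagonal factor of `xcheck q i ∘ xcheck q j`. -/
def diagFactor (q : ℂ) (i j : ZMod N) (f : MvPowerSeries (ZMod N) ℂ) :
    MvPowerSeries (ZMod N) ℂ :=
  fun ν => q ^ (-(ν i : ℤ) - ν j) * q ^ (ν (i - 1) + ν (j - 1)) * f ν

lemma diagFactor_comm (q : ℂ) (i j : ZMod N) (f : MvPowerSeries (ZMod N) ℂ) :
    diagFactor q i j f = diagFactor q j i f := by
  funext ν
  rw [diagFactor, diagFactor, add_comm (ν (i - 1)), neg_sub_comm]

lemma xcheck_xcheck {q : ℂ} (hq0 : q ≠ 0) (i j : ZMod N) (f : MvPowerSeries (ZMod N) ℂ) :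
    xcheck q i (xcheck q j f) = ((if j = i - 1 then q else 1) * (if j = i then q⁻¹ else 1)) •
      (MvPowerSeries.X i * MvPowerSeries.X j * diagFactor q i j f) := by
  rw [xcheck, xcheck, pmap_X_mul, pinv_smul, pinv_X_mul hq0, smul_smul, mul_smul_comm, mul_assoc]
  congr 3
  funext ν
  simp only [pinv, pmap, diagFactor]
  rw [sub_eq_add_neg (-(ν i : ℤ)), zpow_add₀ hq0, pow_add]
  ring

lemma xcheck_comm {q : ℂ} (hq0 : q ≠ 0) {i j : ZMod N} (h1 : j ≠ i - 1) (h2 : i ≠ j - 1) :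
    xcheckLin q i * xcheckLin q j = xcheckLin q j * xcheckLin q i := by
  refine LinearMap.ext fun f => ?_
  change xcheck q i (xcheck q j f) = xcheck q j (xcheck q i f)
  rw [xcheck_xcheck hq0, xcheck_xcheck hq0, if_neg h1, if_neg h2, mul_comm (MvPowerSeries.X i),
    diagFactor_comm]
  simp only [eq_comm]

lemma xcheck_qcomm {q : ℂ} (hq0 : q ≠ 0) {i j : ZMod N} (h1 : j = i - 1) (h2 : i ≠ j - 1)
    (h3 : i ≠ j) :
    xcheckLin q i * xcheckLin q j = q • (xcheckLin q j * xcheckLin q i) := by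
  refine LinearMap.ext fun f => ?_
  change xcheck q i (xcheck q j f) = q • xcheck q j (xcheck q i f)
  rw [xcheck_xcheck hq0, xcheck_xcheck hq0, if_pos h1, if_neg h2, if_neg h3, if_neg h3.symm,
    mul_comm (MvPowerSeries.X i), smul_smul, mul_one, mul_one, mul_one, diagFactor_comm]

/-- The operator induced by `xcheck` on power series modulo order `≥ k`. -/
def xcheckQuot (q : ℂ) (k : ℕ) (i : ZMod N) :
    Module.End ℂ (MvPowerSeries (ZMod N) ℂ ⧸ orderGE N k) :=
  (orderGE N k).mapQ (orderGE N k) (xcheckLin q i)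
    fun f hf ν hν => xcheck_degreeRaising q i k f hf ν (by omega)

lemma xcheckQuot_comm {q : ℂ} (hq0 : q ≠ 0) (k : ℕ) {i j : ZMod N} (h1 : j ≠ i - 1)
    (h2 : i ≠ j - 1) : Commute (xcheckQuot q k i) (xcheckQuot q k j) := by
  refine LinearMap.ext fun w => ?_
  obtain ⟨f, rfl⟩ := Submodule.Quotient.mk_surjective _ w
  exact congrArg Submodule.Quotient.mk (LinearMap.congr_fun (xcheck_comm hq0 h1 h2) f)

lemma xcheckQuot_qcomm {q : ℂ} (hq0 : q ≠ 0) (k : ℕ) {i j : ZMod N} (h1 : j = i - 1)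
    (h2 : i ≠ j - 1) (h3 : i ≠ j) :
    xcheckQuot q k i * xcheckQuot q k j = q • (xcheckQuot q k j * xcheckQuot q k i) := by
  refine LinearMap.ext fun w => ?_
  obtain ⟨f, rfl⟩ := Submodule.Quotient.mk_surjective _ w
  exact congrArg Submodule.Quotient.mk (LinearMap.congr_fun (xcheck_qcomm hq0 h1 h2 h3) f)

/-- `T` induces `t` on power series modulo order `≥ k`. -/
def Induces (k : ℕ) (T : MvPowerSeries (ZMod N) ℂ → MvPowerSeries (ZMod N) ℂ)
    (t : Module.End ℂ (MvPowerSeries (ZMod N) ℂ ⧸ orderGE N k)) : Prop :=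
  Function.Semiconj (orderGE N k).mkQ T t

variable {k : ℕ}

lemma xcheck_induces (q : ℂ) (k : ℕ) (i : ZMod N) : Induces k (xcheck q i) (xcheckQuot q k i) :=
  fun _ => rfl

lemma Induces.comp {S T : MvPowerSeries (ZMod N) ℂ → MvPowerSeries (ZMod N) ℂ}
    {s t : Module.End ℂ (MvPowerSeries (ZMod N) ℂ ⧸ orderGE N k)}
    (hS : Induces k S s) (hT : Induces k T t) : Induces k (S ∘ T) (s * t) :=
  fun f => (hS (T f)).trans (congrArg s (hT f))

lemma Induces.iterate {T : MvPowerSeries (ZMod N) ℂ → MvPowerSeries (ZMod N) ℂ}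
    {t : Module.End ℂ (MvPowerSeries (ZMod N) ℂ ⧸ orderGE N k)}
    (hT : Induces k T t) (n : ℕ) : Induces k T^[n] (t ^ n) := by
  intro f
  rw [Module.End.pow_apply]
  exact Function.Semiconj.iterate_right hT n f

lemma Induces.compAsc {F : ℕ → MvPowerSeries (ZMod N) ℂ → MvPowerSeries (ZMod N) ℂ}
    {t : ℕ → Module.End ℂ (MvPowerSeries (ZMod N) ℂ ⧸ orderGE N k)}
    (h : ∀ m, Induces k (F m) (t m)) (n : ℕ) : Induces k (compAsc F n) (ascProd t n) := by
  induction n with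
  | zero => exact fun _ => rfl
  | succ n ih => exact ih.comp (h n)

lemma Induces.compDesc {F : ℕ → MvPowerSeries (ZMod N) ℂ → MvPowerSeries (ZMod N) ℂ}
    {t : ℕ → Module.End ℂ (MvPowerSeries (ZMod N) ℂ ⧸ orderGE N k)}
    (h : ∀ m, Induces k (F m) (t m)) (n : ℕ) : Induces k (compDesc F n) (descProd t n) := by
  induction n with
  | zero => exact fun _ => rfl
  | succ n ih => exact (h n).comp ih

lemma Induces.pow_eq_zero {T : MvPowerSeries (ZMod N) ℂ → MvPowerSeries (ZMod N) ℂ}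
    {t : Module.End ℂ (MvPowerSeries (ZMod N) ℂ ⧸ orderGE N k)}
    (h : Induces k T t) (hT : DegreeRaising T) : t ^ k = 0 := by
  refine LinearMap.ext fun w => ?_
  obtain ⟨f, rfl⟩ := (orderGE N k).mkQ_surjective w
  rw [← h.iterate k f]
  exact (Submodule.Quotient.mk_eq_zero _).2 (hT.iterate_mem f k)

lemma Induces.eqExp {T : MvPowerSeries (ZMod N) ℂ → MvPowerSeries (ZMod N) ℂ}
    {t : Module.End ℂ (MvPowerSeries (ZMod N) ℂ ⧸ orderGE N k)}
    (h : Induces k T t) (hT : DegreeRaising T) (q : ℂ) :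
    Induces k (eqExp q T) (qExpTrunc q k t) := by
  intro f
  have e : qExpTrunc q k t ((orderGE N k).mkQ f)
      = (orderGE N k).mkQ (∑ n ∈ Finset.range k, qCoeff q n • T^[n] f) := by
    rw [map_sum, qExpTrunc, LinearMap.sum_apply]
    refine Finset.sum_congr rfl fun n _ => ?_
    rw [map_smul, LinearMap.smul_apply, h.iterate n f]
  rw [e]
  refine (Submodule.Quotient.eq _).2 fun ν hν => ?_
  have hsum : MvPowerSeries.coeff ν (∑ n ∈ Finset.range k, qCoeff q n • T^[n] f)
      = ∑ n ∈ Finset.range k, qCoeff q n * MvPowerSeries.coeff ν (T^[n] f) := by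
    simp
  change _root_.eqExp q T f ν
    - MvPowerSeries.coeff ν (∑ n ∈ Finset.range k, qCoeff q n • T^[n] f) = 0
  rw [hsum, sub_eq_zero]
  refine Finset.sum_subset (Finset.range_mono hν) fun n _ hn => ?_
  change _ * (T^[n] f) ν = 0
  rw [hT.iterate_mem f n ν (by simp at hn; omega), mul_zero]

lemma eq_of_forall_mkQ {f g : MvPowerSeries (ZMod N) ℂ}
    (h : ∀ k, (orderGE N k).mkQ f = (orderGE N k).mkQ g) : f = g := by
  funext ν
  exact sub_eq_zero.1 ((Submodule.Quotient.eq _).1 (h (degOf ν + 1)) ν (Nat.lt_succ_self _))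

lemma Pblock_induces (q : ℂ) [NeZero N] (k : ℕ) (s : ZMod N) :
    Induces k (Pblock q N s)
      (ascProd (fun j => qExpTrunc q k
          (ascProd (fun m => xcheckQuot q k (s + (m : ZMod N))) (j + 1))) (N - 1)
        * descProd (fun j => qExpTrunc q k (xcheckQuot q k (s + ((j + 1 : ℕ) : ZMod N))))
          (N - 1)) := by
  refine Induces.comp (Induces.compAsc (fun j => ?_) _) (Induces.compDesc (fun j => ?_) _)
  · exact (Induces.compAsc (fun _ => xcheck_induces q k _) (j + 1)).eqExp
      (DegreeRaising.compAsc (fun _ => xcheck_degreeRaising q _) j) q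
  · exact (xcheck_induces q k _).eqExp (xcheck_degreeRaising q _) q

end Truncation

/-- **Proposition 2.4**: `P_s` is independent of `s`, i.e. the left block of
the Hamiltonian is invariant under the cyclic rotation `x̌_i ↦ x̌_{i+1}`. -/
theorem cyclic_symmetry (q : ℂ) (hq0 : q ≠ 0) (hq : ∀ n : ℕ, 0 < n → q ^ n ≠ 1)
    (N : ℕ) [NeZero N] (hN : 3 ≤ N) :
    ∀ s : ZMod N, Pblock q N s = Pblock q N (s + 1) := by
  obtain ⟨n, rfl⟩ : ∃ n, N = n + 2 := ⟨N - 2, by omega⟩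
  intro s
  funext f
  refine eq_of_forall_mkQ fun k => ?_
  rw [Pblock_induces q k s f, Pblock_induces q k (s + 1) f]
  congr 1
  have hne {c d : ℕ} (h : ¬ c + 1 ≡ d [MOD n + 2]) :
      s + (c : ZMod (n + 2)) ≠ s + (d : ZMod (n + 2)) - 1 := by
    rw [Ne, eq_sub_iff_add_eq, add_assoc, add_right_inj, ← Nat.cast_succ,
      ZMod.natCast_eq_natCast_iff]
    exact h
  have hne' {c d : ℕ} (h : ¬ c ≡ d [MOD n + 2]) :
      s + (c : ZMod (n + 2)) ≠ s + (d : ZMod (n + 2)) := by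
    rwa [Ne, add_right_inj, ZMod.natCast_eq_natCast_iff]
  have hmod {c d : ℕ} (hc : c ≤ n + 2) (hd : d < n + 2) (h : c ≠ d) (h' : c ≠ n + 2 ∨ d ≠ 0) :
      ¬ c ≡ d [MOD n + 2] := by
    intro hcd
    rw [Nat.ModEq, Nat.mod_eq_of_lt hd] at hcd
    rcases hc.lt_or_eq with hc | rfl
    · rw [Nat.mod_eq_of_lt hc] at hcd
      exact h hcd
    · rw [Nat.mod_self] at hcd
      omega
  have hs : s + ((n + 2 : ℕ) : ZMod (n + 2)) = s + ((0 : ℕ) : ZMod (n + 2)) := by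
    rw [ZMod.natCast_self, Nat.cast_zero]
  have key := qExpTrunc_rotation hq0 hq (k := k) (n := n) (by omega)
    (fun m => xcheckQuot q k (s + (m : ZMod (n + 2))))
    (fun i hi => xcheckQuot_qcomm hq0 k (by push_cast; ring)
      (hne (hmod (by omega) (by omega) (by omega) (by omega)))
      (hne' (hmod (by omega) (by omega) (by omega) (by omega))))
    (fun i j hij hj h => xcheckQuot_comm hq0 k
      (hne (hmod (by omega) (by omega) (by omega) (by omega)))
      (hne (hmod (by omega) (by omega) (by omega) (by omega))))
    (xcheckQuot_qcomm hq0 k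
      (by rw [eq_sub_iff_add_eq, add_assoc, ← Nat.cast_succ, hs])
      (hne (hmod (by omega) (by omega) (by omega) (by omega)))
      (hne' (hmod (by omega) (by omega) (by omega) (by omega))))
    (fun _ => (xcheck_induces q k _).pow_eq_zero (xcheck_degreeRaising q _))
    (fun j => (Induces.compAsc (fun _ => xcheck_induces q k _) (j + 1)).pow_eq_zero
      (DegreeRaising.compAsc (fun _ => xcheck_degreeRaising q _) j))
  have e (m : ℕ) : s + 1 + (m : ZMod (n + 2)) = s + ((m + 1 : ℕ) : ZMod (n + 2)) := by
    push_cast; ring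
  simp only [e]
  refine key.trans ?_
  change _ = _ * (_ * _)
  simp only [← hs]
  rfl
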